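/- The dominating number 𝔡 is the least cardinality of an independent family B on ω separating points such that nwd(X(B)) is not a P⁻-ideal. That is: (a) for every independent family B separating points with |B| < 𝔡, the ideal nwd(X(B)) is a P⁻-ideal; and (b) there exists an independent family B separating points of cardinality 𝔡 such that nwd(X(B)) is not a P⁻-ideal. -/

import Mathlib

open Cardinal Set

/-- An ideal on a (countably infinite) set: contains finite sets, not the whole set,
closed under subsets and finite unions. -/
def IsIdeal {α : Type*} (I : Set (Set α)) : Prop :=
  (∀ A : Set α, A.Finite → A ∈ I) ∧ (Set.univ ∉ I) ∧
    (∀ A B : Set α, A ∈ I → B ⊆ A → B ∈ I) ∧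
    (∀ A B : Set α, A ∈ I → B ∈ I → A ∪ B ∈ I)

/-- `J ≤_K I`: there is a function from the underlying set of `I` to that of `J`
pulling members of `J` back into `I`. -/
def KatetovLE {α β : Type*} (J : Set (Set β)) (I : Set (Set α)) : Prop :=
  ∃ f : α → β, ∀ A ∈ J, f ⁻¹' A ∈ I

def FiniteToOne {α β : Type*} (f : α → β) : Prop := ∀ b : β, (f ⁻¹' {b}).Finite

/-- `J ≤_KB I`: Katětov-Blass order (finite-to-one witness). -/
def KatetovBlassLE {α β : Type*} (J : Set (Set β)) (I : Set (Set α)) : Prop :=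
  ∃ f : α → β, FiniteToOne f ∧ ∀ A ∈ J, f ⁻¹' A ∈ I

/-- The restriction `I ↾ X`, as an ideal on the subtype `X`. -/
def restrictIdeal {α : Type*} (I : Set (Set α)) (X : Set α) : Set (Set ↥X) :=
  {A : Set ↥X | (Subtype.val '' A) ∈ I}

/-- The ideal generated by a family `G` together with the finite sets. -/
def genIdeal {α : Type*} (G : Set (Set α)) : Set (Set α) :=
  {A | ∃ (S : Finset (Set α)) (F : Set α), ↑S ⊆ G ∧ F.Finite ∧ A ⊆ F ∪ ⋃₀ ↑S}

/-- Generators of the eventually different ideal: columns and graphs of functions. -/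
def EDGenerators : Set (Set (ℕ × ℕ)) :=
  {C | ∃ n : ℕ, C = {p : ℕ × ℕ | p.1 = n}} ∪
    {G | ∃ f : ℕ → ℕ, G = {p : ℕ × ℕ | p.2 = f p.1}}

/-- The eventually different ideal on `ω × ω`. -/
def ED : Set (Set (ℕ × ℕ)) := genIdeal EDGenerators

/-- Generators of `fin × fin`: columns and regions under graphs. -/
def FinFinGenerators : Set (Set (ℕ × ℕ)) :=
  {C | ∃ n : ℕ, C = {p : ℕ × ℕ | p.1 = n}} ∪
    {D | ∃ f : ℕ → ℕ, D = {p : ℕ × ℕ | p.2 ≤ f p.1}}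

/-- The ideal `fin × fin` on `ω × ω`. -/
def FinTimesFin : Set (Set (ℕ × ℕ)) := genIdeal FinFinGenerators

def Delta : Set (ℕ × ℕ) := {p : ℕ × ℕ | p.2 ≤ p.1}

/-- `ED_fin`, the restriction of `ED` to `Δ = {(n,m) : m ≤ n}`. -/
def EDfin : Set (Set ↥Delta) := restrictIdeal ED Delta

/-- The ideal of nowhere dense subsets of the rationals. -/
def nwdQ : Set (Set ℚ) := {A : Set ℚ | IsNowhereDense A}

/-- The copy of a family of subsets of `α` inside the Cantor space `α → Bool`
(via characteristic functions). -/
def cantorCopy {α : Type*} (I : Set (Set α)) : Set (α → Bool) :=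
  {x : α → Bool | {a : α | x a = true} ∈ I}

def IsUltrafilterSet (U : Set (Set ℕ)) : Prop :=
  Set.univ ∈ U ∧ ∅ ∉ U ∧ (∀ A B : Set ℕ, A ∈ U → A ⊆ B → B ∈ U) ∧
    (∀ A B : Set ℕ, A ∈ U → B ∈ U → A ∩ B ∈ U) ∧
    (∀ A : Set ℕ, A ∈ U ∨ (Set.univ \ A) ∈ U)

def NonprincipalUF (U : Set (Set ℕ)) : Prop := ∀ A : Set ℕ, A.Finite → A ∉ U

/-- The dual ideal `U*` of an ultrafilter `U`. -/
def dualIdeal (U : Set (Set ℕ)) : Set (Set ℕ) := {A : Set ℕ | Set.univ \ A ∈ U}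

/-- `U` is a Ramsey ultrafilter. -/
def IsRamseyUF (U : Set (Set ℕ)) : Prop :=
  ∀ P : ℕ → Set ℕ, Pairwise (Function.onFun Disjoint P) → (⋃ n, P n) = Set.univ →
    (∀ n, P n ∉ U) → ∃ A ∈ U, ∀ n, (A ∩ P n).Subsingleton

def IsTight (I : Set (Set ℕ)) : Prop :=
  ∀ X : ℕ → Set ℕ, (∀ n, X n ∉ I) → ∃ Y ∈ I, ∀ n, (Y ∩ X n).Infinite

def IsPIdeal (I : Set (Set ℕ)) : Prop :=
  ∀ A : ℕ → Set ℕ, (∀ n, A n ∈ I) → ∃ B ∈ I, ∀ n, (A n \ B).Finite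

def IsPMinus (I : Set (Set ℕ)) : Prop :=
  ∀ X : Set ℕ, X ∉ I → ∀ Xs : ℕ → Set ℕ, (∀ n, Xs n ⊆ X) → (∀ n, X \ Xs n ∈ I) →
    ∃ Y : Set ℕ, Y ∉ I ∧ ∀ n, (Y \ Xs n).Finite

def IsQPlus (I : Set (Set ℕ)) : Prop :=
  ∀ X : Set ℕ, X ∉ I → ∀ P : ℕ → Set ℕ, (∀ n, (P n).Finite) →
    Pairwise (Function.onFun Disjoint P) → (⋃ n, P n) = X →
    ∃ A : Set ℕ, A ∉ I ∧ A ⊆ X ∧ ∀ n, (A ∩ P n).Subsingleton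

def AlmostSubset (A B : Set ℕ) : Prop := (A \ B).Finite

/-- The tower number 𝔱. -/
noncomputable def towerNumber : Cardinal :=
  sInf {c : Cardinal | ∃ T : Set (Set ℕ),
    (∀ A ∈ T, A.Infinite) ∧
    (∀ A ∈ T, ∀ B ∈ T, AlmostSubset A B ∨ AlmostSubset B A) ∧
    (¬ ∃ A : Set ℕ, A.Infinite ∧ ∀ B ∈ T, AlmostSubset A B) ∧
    Cardinal.mk T = c}

/-- cov(M): covering number of the meager ideal of Baire space. -/
noncomputable def covM : Cardinal :=
  sInf {c : Cardinal | ∃ F : Set (Set (ℕ → ℕ)),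
    (∀ A ∈ F, IsMeagre A) ∧ ⋃₀ F = Set.univ ∧ Cardinal.mk F = c}

/-- The dominating number 𝔡. -/
noncomputable def dNumber : Cardinal :=
  sInf {c : Cardinal | ∃ D : Set (ℕ → ℕ),
    (∀ f : ℕ → ℕ, ∃ g ∈ D, ∀ᶠ n in Filter.atTop, f n ≤ g n) ∧ Cardinal.mk D = c}

/-- The cofinality of an ideal: least size of a cofinal subfamily. -/
noncomputable def idealCof (I : Set (Set ℕ)) : Cardinal :=
  sInf {c : Cardinal | ∃ C : Set (Set ℕ), C ⊆ I ∧ (∀ A ∈ I, ∃ B ∈ C, A ⊆ B) ∧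
    Cardinal.mk C = c}

/-- An increasing interval partition of ω, given by its sequence of endpoints. -/
structure IncIntervalPartition where
  e : ℕ → ℕ
  zero : e 0 = 0
  mono : StrictMono e
  incr : ∀ n : ℕ, e (n + 1) - e n < e (n + 2) - e (n + 1)

def IncIntervalPartition.block (P : IncIntervalPartition) (n : ℕ) : Set ℕ :=
  Set.Ico (P.e n) (P.e (n + 1))

/-- A selector of an interval partition: a set meeting each block in exactly one point. -/
def IsSelector (P : IncIntervalPartition) (S : Set ℕ) : Prop :=
  ∀ n : ℕ, ∃! x : ℕ, x ∈ S ∩ P.block n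

/-- The ideal `ED_P` generated by the selectors of `P` (and the finite sets). -/
def EDP (P : IncIntervalPartition) : Set (Set ℕ) := genIdeal {S : Set ℕ | IsSelector P S}

/-- A Fréchet space: closure points are limits of sequences. -/
def IsFrechet (α : Type*) [TopologicalSpace α] : Prop :=
  ∀ (a : α) (Y : Set α), a ∈ closure Y →
    ∃ u : ℕ → α, (∀ n, u n ∈ Y) ∧ Filter.Tendsto u Filter.atTop (nhds a)

/-- Zero-dimensional: the clopen sets form a basis. -/
def ZeroDimensional (α : Type*) [TopologicalSpace α] : Prop :=
  TopologicalSpace.IsTopologicalBasis {U : Set α | IsClopen U}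

/-- A local π-base at a point. -/
def IsLocalPiBase {α : Type*} [TopologicalSpace α] (B : Set (Set α)) (b : α) : Prop :=
  (∀ U ∈ B, IsOpen U ∧ U.Nonempty) ∧
    ∀ V : Set α, IsOpen V → b ∈ V → ∃ U ∈ B, U ⊆ V

/-- Every point has uncountable π-character. -/
def UncountablePiCharEverywhere (α : Type*) [TopologicalSpace α] : Prop :=
  ∀ (b : α) (B : Set (Set α)), IsLocalPiBase B b → ¬ B.Countable

/-- An independent family on ω. -/
def IsIndepFamily (B : Set (Set ℕ)) : Prop :=
  (∀ A ∈ B, A.Infinite) ∧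
    ∀ F G : Finset (Set ℕ), ↑F ⊆ B → ↑G ⊆ B → Disjoint F G →
      ((⋂ A ∈ F, A) ∩ ⋂ A ∈ G, (Set.univ \ A)).Infinite

def SeparatesPointsFam (B : Set (Set ℕ)) : Prop :=
  ∀ m n : ℕ, m ≠ n → ∃ A ∈ B, m ∈ A ∧ n ∉ A

/-- The envelope of an independent family: finite Boolean combinations. -/
def envSets (B : Set (Set ℕ)) : Set (Set ℕ) :=
  {V : Set ℕ | ∃ F G : Finset (Set ℕ), ↑F ⊆ B ∧ ↑G ⊆ B ∧ Disjoint F G ∧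
    V = (⋂ A ∈ F, A) ∩ ⋂ A ∈ G, (Set.univ \ A)}

/-- The topology on ω generated by the envelope of `B`. -/
def XBtop (B : Set (Set ℕ)) : TopologicalSpace ℕ :=
  TopologicalSpace.generateFrom (envSets B)

/-- The ideal of nowhere dense subsets of the space `X(B)`. -/
def nwdXB (B : Set (Set ℕ)) : Set (Set ℕ) :=
  {A : Set ℕ | @IsNowhereDense ℕ (XBtop B) A}

/-- `non*(ED_fin)`. -/
noncomputable def nonStarEDfin : Cardinal :=
  sInf {c : Cardinal | ∃ H : Set (Set ↥Delta),
    (∀ A ∈ H, A.Infinite) ∧ (∀ A ∈ EDfin, ∃ B ∈ H, (A ∩ B).Finite) ∧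
    Cardinal.mk H = c}

open Filter Topology TopologicalSpace

theorem aleph0_le_mk_of_dominating {D : Set (ℕ → ℕ)}
    (hD : ∀ f : ℕ → ℕ, ∃ g ∈ D, ∀ᶠ n in atTop, f n ≤ g n) : ℵ₀ ≤ #D := by
  by_contra! h
  have hfin : D.Finite := Cardinal.lt_aleph0_iff_set_finite.1 h
  obtain ⟨g, hg, hle⟩ := hD fun n => ∑ g ∈ hfin.toFinset, g n + 1
  obtain ⟨n, hn⟩ := hle.exists
  have : g n ≤ ∑ g ∈ hfin.toFinset, g n :=
    Finset.single_le_sum (f := fun g : ℕ → ℕ => g n) (fun _ _ => Nat.zero_le _)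
      (hfin.mem_toFinset.2 hg)
  omega

theorem exists_dominating_mk_eq_dNumber :
    ∃ D : Set (ℕ → ℕ), (∀ f : ℕ → ℕ, ∃ g ∈ D, ∀ᶠ n in atTop, f n ≤ g n) ∧ #D = dNumber := by
  have := csInf_mem (s := {c : Cardinal | ∃ D : Set (ℕ → ℕ),
    (∀ f : ℕ → ℕ, ∃ g ∈ D, ∀ᶠ n in atTop, f n ≤ g n) ∧ #D = c})
    ⟨_, univ, fun f => ⟨f, mem_univ f, Eventually.of_forall fun _ => le_rfl⟩, rfl⟩
  exact this

theorem aleph0_le_dNumber : ℵ₀ ≤ dNumber := by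
  obtain ⟨D, hD, h⟩ := exists_dominating_mk_eq_dNumber
  exact h ▸ aleph0_le_mk_of_dominating hD

theorem exists_not_le_of_mk_lt_dNumber {D : Set (ℕ → ℕ)} (h : #D < dNumber) :
    ∃ g : ℕ → ℕ, ∀ f ∈ D, ∃ n, f n < g n := by
  by_contra! hD
  refine h.not_ge (csInf_le' ⟨D, fun f => ?_, rfl⟩)
  obtain ⟨g, hg, hle⟩ := hD f
  exact ⟨g, hg, Eventually.of_forall hle⟩

theorem isTopologicalBasis_envSets (B : Set (Set ℕ)) :
    @IsTopologicalBasis ℕ (XBtop B) (envSets B) := by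
  classical
  let := XBtop B
  refine ⟨?_, ?_, rfl⟩
  · rintro _ ⟨F₁, G₁, hF₁, hG₁, -, rfl⟩ _ ⟨F₂, G₂, hF₂, hG₂, -, rfl⟩ x hx
    simp only [mem_inter_iff, mem_iInter, Set.mem_sdiff, mem_univ, true_and] at hx
    refine ⟨_, ⟨F₁ ∪ F₂, G₁ ∪ G₂, ?_, ?_, ?_, rfl⟩, ?_, ?_⟩
    · simp [hF₁, hF₂]
    · simp [hG₁, hG₂]
    · rw [Finset.disjoint_left]
      intro A hA hA'
      grind
    · simp only [mem_inter_iff, mem_iInter, Set.mem_sdiff, mem_univ, true_and]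
      grind
    · intro y hy
      simp only [mem_inter_iff, mem_iInter, Set.mem_sdiff, mem_univ, true_and] at hy ⊢
      grind
  · refine eq_univ_of_univ_subset (subset_sUnion_of_mem ⟨∅, ∅, ?_⟩)
    simp

theorem mk_envSets_lt {B : Set (Set ℕ)} {κ : Cardinal} (hκ : ℵ₀ ≤ κ) (h : #B < κ) :
    #(envSets B) < κ := by
  classical
  let e : Finset B × Finset B → Set ℕ := fun p =>
    (⋂ A ∈ p.1.map (Function.Embedding.subtype _), A) ∩
      ⋂ A ∈ p.2.map (Function.Embedding.subtype _), (univ \ A)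
  have hsub : envSets B ⊆ range e := by
    rintro _ ⟨F, G, hF, hG, -, rfl⟩
    refine ⟨(F.subtype (· ∈ B), G.subtype (· ∈ B)), ?_⟩
    simp only [e]
    rw [Finset.subtype_map_of_mem fun x hx => hF hx,
      Finset.subtype_map_of_mem fun x hx => hG hx]
  have hle : #(envSets B) ≤ #(Finset B) * #(Finset B) := by
    calc _ ≤ #(range e) := mk_le_mk_of_subset hsub
      _ ≤ #(Finset B × Finset B) := mk_range_le
      _ = _ := by simp
  refine hle.trans_lt (mul_lt_of_lt hκ ?_ ?_) <;>
  · cases finite_or_infinite B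
    · exact (lt_aleph0_of_finite _).trans_le hκ
    · rwa [mk_finset_of_infinite]

theorem IsNowhereDense.union {X : Type*} [TopologicalSpace X] {A C : Set X}
    (hA : IsNowhereDense A) (hC : IsNowhereDense C) : IsNowhereDense (A ∪ C) := by
  rw [IsNowhereDense, closure_union, interior_union_isClosed_of_interior_empty isClosed_closure hC]
  exact hA

theorem isNowhereDense_biUnion_finset {X ι : Type*} [TopologicalSpace X] (s : Finset ι)
    {f : ι → Set X} (h : ∀ i ∈ s, IsNowhereDense (f i)) : IsNowhereDense (⋃ i ∈ s, f i) := by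
  classical
  induction s using Finset.induction_on with
  | empty => simp
  | insert a s _ ih =>
    rw [Finset.set_biUnion_insert]
    exact (h a (by simp)).union (ih fun i hi => h i (by simp [hi]))

theorem inter_nonempty_of_isNowhereDense_diff {X : Type*} [TopologicalSpace X] {A C W : Set X}
    (hAC : IsNowhereDense (A \ C)) (hW : IsOpen W) (hne : W.Nonempty) (hWA : W ⊆ closure A) :
    (W ∩ C).Nonempty := by
  by_contra hemp
  have hsub : W ∩ A ⊆ A \ C := fun x hx => ⟨hx.2, fun hC => hemp ⟨x, hx.1, hC⟩⟩
  have hcl : W ⊆ closure (A \ C) := fun x hx =>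
    closure_mono hsub (hW.inter_closure ⟨hx, hWA hx⟩)
  have : W ⊆ interior (closure (A \ C)) := interior_maximal hcl hW
  rw [hAC] at this
  exact hne.ne_empty (subset_empty_iff.1 this)

theorem isPMinus_isNowhereDense_of_mk_lt_dNumber [TopologicalSpace ℕ] {𝓑 : Set (Set ℕ)}
    (h𝓑 : IsTopologicalBasis 𝓑) (hcard : #𝓑 < dNumber) :
    IsPMinus {A : Set ℕ | IsNowhereDense A} := by
  classical
  intro X hX Xs _ hXs
  set U := interior (closure X)
  have hUne : U.Nonempty := nonempty_iff_ne_empty.2 hX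
  let Z : ℕ → Set ℕ := fun n => ⋂ i ∈ Finset.range (n + 1), Xs i
  have hZ : ∀ n, IsNowhereDense (X \ Z n) := fun n => by
    have : X \ Z n = ⋃ i ∈ Finset.range (n + 1), (X \ Xs i) := by
      ext x
      simp only [Z, Set.mem_sdiff, mem_iInter, mem_iUnion]
      grind
    rw [this]
    exact isNowhereDense_biUnion_finset _ fun i _ => hXs i
  have hmeet : ∀ V ∈ 𝓑, (V ∩ U).Nonempty → ∀ n, ∃ k, k ∈ (V ∩ U) ∩ Z n :=
    fun V hV hne n => inter_nonempty_of_isNowhereDense_diff (hZ n)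
      ((h𝓑.isOpen hV).inter isOpen_interior) hne (inter_subset_right.trans interior_subset)
  have hpick : ∀ V : 𝓑, ∃ f : ℕ → ℕ, (V.1 ∩ U).Nonempty → ∀ n, f n ∈ (V.1 ∩ U) ∩ Z n := by
    intro V
    by_cases hne : (V.1 ∩ U).Nonempty
    · choose f hf using hmeet V V.2 hne
      exact ⟨f, fun _ => hf⟩
    · exact ⟨0, fun h => absurd h hne⟩
  choose f hf using hpick
  obtain ⟨g, hg⟩ := exists_not_le_of_mk_lt_dNumber
    (D := range f) (mk_range_le.trans_lt hcard)
  refine ⟨{k | ∃ n, k < g n ∧ k ∈ Z n}, fun hY => ?_, fun m => ?_⟩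
  · have hdense : U ⊆ closure {k | ∃ n, k < g n ∧ k ∈ Z n} := by
      intro x hx
      rw [h𝓑.mem_closure_iff]
      intro V hV hxV
      obtain ⟨n, hn⟩ := hg _ ⟨⟨V, hV⟩, rfl⟩
      have := hf ⟨V, hV⟩ ⟨x, hxV, hx⟩ n
      exact ⟨_, this.1.1, n, hn, this.2⟩
    have hin : U ⊆ interior (closure {k | ∃ n, k < g n ∧ k ∈ Z n}) :=
      interior_maximal hdense isOpen_interior
    rw [show interior (closure {k | ∃ n, k < g n ∧ k ∈ Z n}) = ∅ from hY] at hin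
    exact hUne.ne_empty (subset_empty_iff.1 hin)
  · refine ((Finset.range m).finite_toSet.biUnion fun n _ => finite_lt_nat (g n)).subset ?_
    rintro k ⟨⟨n, hn, hk⟩, hkm⟩
    simp only [Z, mem_iInter, Finset.mem_range] at hk
    simp only [Finset.coe_range, mem_iUnion, mem_Iio, mem_ofPred_eq, exists_prop]
    refine ⟨n, ?_, hn⟩
    by_contra! hmn
    exact hkm (hk m (by omega))

/-- The Fichtenholz–Kantorovich–Hausdorff theorem: there is an independent family of subsets
of `ℕ` of size continuum. -/
theorem exists_independent_of_mk_le_continuum {ι : Type} (h : #ι ≤ 𝔠) :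
    ∃ C : ι → Set ℕ, ∀ F G : Finset ι, Disjoint F G →
      {m | (∀ i ∈ F, m ∈ C i) ∧ ∀ i ∈ G, m ∉ C i}.Infinite := by
  classical
  obtain ⟨x⟩ : Nonempty (ι ↪ (ℕ → ℕ)) := by
    rw [← Cardinal.le_def]
    simpa using h
  let t : ι → ℕ → List ℕ := fun i N => (List.range N).map (x i)
  let E : ℕ × Finset (List ℕ) → ℕ := Encodable.encode
  refine ⟨fun i => E '' {p | t i p.1 ∈ p.2}, fun F G hFG => ?_⟩
  have hsep : ∀ i j : ι, i ≠ j → ∃ k, x i k ≠ x j k := fun i j hij =>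
    Function.ne_iff.1 (x.injective.ne hij)
  choose! d hd using hsep
  let N₀ := ∑ i ∈ F, ∑ j ∈ G, (d i j + 1)
  have hN₀ : ∀ i ∈ F, ∀ j ∈ G, d i j < N₀ := fun i hi j hj =>
    calc d i j < d i j + 1 := Nat.lt_succ_self _
      _ ≤ ∑ j ∈ G, (d i j + 1) :=
        Finset.single_le_sum (f := fun j => d i j + 1) (fun _ _ => Nat.zero_le _) hj
      _ ≤ N₀ := Finset.single_le_sum (f := fun i => ∑ j ∈ G, (d i j + 1))
        (fun _ _ => Nat.zero_le _) hi
  refine (infinite_range_of_injective (f := fun n => E (N₀ + n, F.image (t · (N₀ + n)))) ?_).mono ?_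
  · intro a b hab
    have := congrArg Prod.fst (Encodable.encode_injective hab)
    simpa using this
  · rintro _ ⟨n, rfl⟩
    refine ⟨fun i hi => mem_image_of_mem _ (Finset.mem_image_of_mem (t · (N₀ + n)) hi),
      fun j hj hmem => ?_⟩
    rw [Encodable.encode_injective.mem_set_image] at hmem
    obtain ⟨i, hi, hij⟩ := Finset.mem_image.1 hmem
    have hne : i ≠ j := fun e => Finset.disjoint_left.1 hFG hi (e ▸ hj)
    refine hd i j hne (List.map_inj_left.1 hij _ (List.mem_range.2 ?_))
    have := hN₀ i hi j hj
    omega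

/-- Identifying `ℕ` with `ℕ × ℕ`, the points lying below the graph of `f` or in one of the
columns `0, …, j`. -/
def belowGraph (f : ℕ → ℕ) (j : ℕ) : Set ℕ :=
  {x | x.unpair.2 ≤ f x.unpair.1 ∨ x.unpair.1 ≤ j}

/-- The cylinder over `C` with `belowGraph f j` removed, corrected so as to contain `p` and
omit `q`; the index is `(f, j, p, q)`. -/
def trimmedCylinder (C : (ℕ → ℕ) × ℕ × ℕ × ℕ → Set ℕ) (i : (ℕ → ℕ) × ℕ × ℕ × ℕ) : Set ℕ :=
  insert i.2.2.1 ({x | x.unpair.2 ∈ C i} \ belowGraph i.1 i.2.1) \ {i.2.2.2}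

theorem infinite_trimmedCylinder_combination {C : (ℕ → ℕ) × ℕ × ℕ × ℕ → Set ℕ}
    {F G : Finset ((ℕ → ℕ) × ℕ × ℕ × ℕ)}
    (hC : {m | (∀ i ∈ F, m ∈ C i) ∧ ∀ i ∈ G, m ∉ C i}.Infinite) :
    ((⋂ i ∈ F, trimmedCylinder C i) ∩ ⋂ i ∈ G, (univ \ trimmedCylinder C i)).Infinite := by
  let n := ∑ i ∈ F, (i.2.1 + 1)
  have hn : ∀ i ∈ F, i.2.1 < n := fun i hi =>
    Finset.single_le_sum (f := fun i : (ℕ → ℕ) × ℕ × ℕ × ℕ => i.2.1 + 1)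
      (fun _ _ => Nat.zero_le _) hi
  let b : (ℕ → ℕ) × ℕ × ℕ × ℕ → ℕ := fun i => i.1 n + i.2.2.1 + i.2.2.2
  let M := ∑ i ∈ F, b i + ∑ i ∈ G, b i
  have hF : ∀ i ∈ F, b i ≤ M := fun i hi =>
    (Finset.single_le_sum (f := b) (fun _ _ => Nat.zero_le _) hi).trans (Nat.le_add_right _ _)
  have hG : ∀ i ∈ G, b i ≤ M := fun i hi =>
    (Finset.single_le_sum (f := b) (fun _ _ => Nat.zero_le _) hi).trans (Nat.le_add_left _ _)
  have hinj : Function.Injective (Nat.pair n) := fun a c h => (Nat.pair_eq_pair.1 h).2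
  refine ((hC.sdiff (finite_le_nat M)).image hinj.injOn).mono ?_
  rintro _ ⟨m, ⟨⟨hmF, hmG⟩, hM⟩, rfl⟩
  have hM : M < m := not_le.1 hM
  have hpair : m ≤ Nat.pair n m := Nat.right_le_pair n m
  simp only [trimmedCylinder, belowGraph, mem_inter_iff, mem_iInter, Set.mem_sdiff, mem_univ, true_and,
    mem_insert_iff, mem_singleton_iff, mem_ofPred_eq, Nat.unpair_pair]
  refine ⟨fun i hi => ⟨Or.inr ⟨hmF i hi, ?_⟩, ?_⟩, fun i hi h => ?_⟩
  · have := hn i hi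
    have := hF i hi
    simp only [b] at this
    omega
  · have := hF i hi
    simp only [b] at this
    omega
  · rcases h.1 with h | h
    · have := hG i hi
      simp only [b] at this
      omega
    · exact hmG i hi h.1

theorem mem_nwdXB_of_infinite_disjoint {B : Set (Set ℕ)} (hB : IsIndepFamily B) {N : Set ℕ}
    (hN : {A ∈ B | Disjoint A N}.Infinite) : N ∈ nwdXB B := by
  classical
  let := XBtop B
  have hbasis : IsTopologicalBasis (envSets B) := isTopologicalBasis_envSets B
  change interior (closure N) = ∅
  by_contra hne
  obtain ⟨x, hx⟩ := nonempty_iff_ne_empty.2 hne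
  obtain ⟨_, ⟨F, G, hF, hG, hFG, rfl⟩, -, hV⟩ :=
    hbasis.exists_subset_of_mem_open hx isOpen_interior
  obtain ⟨A, ⟨hAB, hAN⟩, hA⟩ := hN.exists_notMem_finset (F ∪ G)
  rw [Finset.mem_union, not_or] at hA
  have hF' : ↑(insert A F) ⊆ B := by
    rw [Finset.coe_insert]
    exact insert_subset hAB hF
  have hd : Disjoint (insert A F) G := Finset.disjoint_insert_left.2 ⟨hA.2, hFG⟩
  obtain ⟨y, hy⟩ := (hB.2 _ G hF' hG hd).nonempty
  have hopen := hbasis.isOpen ⟨insert A F, G, hF', hG, hd, rfl⟩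
  have hycl : y ∈ closure N := by
    refine interior_subset (hV ?_)
    rw [Finset.set_biInter_insert] at hy
    exact ⟨hy.1.2, hy.2⟩
  obtain ⟨z, hz, hzN⟩ := mem_closure_iff.1 hycl _ hopen hy
  rw [Finset.set_biInter_insert] at hz
  exact disjoint_left.1 hAN hz.1.1 hzN

theorem nwdXB_mono {B : Set (Set ℕ)} {M N : Set ℕ} (hN : N ∈ nwdXB B) (h : M ⊆ N) :
    M ∈ nwdXB B := by
  let := XBtop B
  exact IsNowhereDense.mono h hN

theorem univ_notMem_nwdXB (B : Set (Set ℕ)) : Set.univ ∉ nwdXB B := by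
  let := XBtop B
  intro h
  have : interior (closure (univ : Set ℕ)) = ∅ := h
  simp at this

theorem exists_indepFamily_mk_eq_dNumber_not_isPMinus :
    ∃ B : Set (Set ℕ), IsIndepFamily B ∧ SeparatesPointsFam B ∧
      #B = dNumber ∧ ¬ IsPMinus (nwdXB B) := by
  classical
  obtain ⟨D, hD, hDcard⟩ := exists_dominating_mk_eq_dNumber
  obtain ⟨C, hC⟩ := exists_independent_of_mk_le_continuum (ι := (ℕ → ℕ) × ℕ × ℕ × ℕ) (by simp)
  have hcomb : ∀ F G : Finset ((ℕ → ℕ) × ℕ × ℕ × ℕ), Disjoint F G →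
      ((⋂ i ∈ F, trimmedCylinder C i) ∩ ⋂ i ∈ G, (univ \ trimmedCylinder C i)).Infinite :=
    fun F G h => infinite_trimmedCylinder_combination (hC F G h)
  have hinj : Function.Injective (trimmedCylinder C) := by
    intro i j hij
    by_contra hne
    obtain ⟨x, hx⟩ := (hcomb {i} {j} (by simpa using hne)).nonempty
    simp [hij] at hx
  let B := trimmedCylinder C '' (D ×ˢ Set.univ)
  have hB : IsIndepFamily B := by
    refine ⟨?_, fun F G hF hG hFG => ?_⟩
    · rintro _ ⟨i, -, rfl⟩
      simpa using hcomb {i} ∅ (by simp)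
    · obtain ⟨F, -, rfl⟩ := Finset.subset_set_image_iff.1 hF
      obtain ⟨G, -, rfl⟩ := Finset.subset_set_image_iff.1 hG
      rw [Finset.set_biInter_finset_image, Finset.set_biInter_finset_image]
      exact hcomb F G ((Finset.disjoint_image hinj).1 hFG)
  have hbelow : ∀ f ∈ D, ∀ j, belowGraph f j ∈ nwdXB B := by
    intro f hf j
    let p := Nat.pair (j + 1) (f (j + 1) + 1)
    have hp : p ∉ belowGraph f j := by simp [belowGraph, p]
    refine mem_nwdXB_of_infinite_disjoint hB
      ((infinite_range_of_injective (f := fun q : ℕ => trimmedCylinder C (f, j, p, q)) ?_).mono ?_)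
    · intro a b hab
      simpa using hinj hab
    · rintro _ ⟨q, rfl⟩
      refine ⟨mem_image_of_mem _ ⟨hf, mem_univ _⟩, disjoint_left.2 ?_⟩
      rintro x ⟨rfl | hx, -⟩
      exacts [hp, hx.2]
  refine ⟨B, hB, fun m n hmn => ?_, ?_, fun hP => ?_⟩
  · obtain ⟨f, hf, -⟩ := hD 0
    exact ⟨_, mem_image_of_mem _ (show (f, 0, m, n) ∈ _ from ⟨hf, mem_univ _⟩),
      ⟨mem_insert _ _, hmn⟩, fun h => h.2 rfl⟩
  · rw [mk_image_eq hinj, ← hDcard, mk_congr (Equiv.Set.prod D univ)]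
    simp [aleph0_le_mk_of_dominating hD]
  · obtain ⟨f₀, hf₀, -⟩ := hD 0
    obtain ⟨Y, hY, hfin⟩ := hP univ (univ_notMem_nwdXB B) (fun n => {x | n < x.unpair.1})
      (fun _ => subset_univ _)
      (fun n => nwdXB_mono (hbelow f₀ hf₀ n) fun x hx => Or.inr (not_lt.1 hx.2))
    have hbdd : ∀ n, ∃ k, ∀ x ∈ Y, x.unpair.1 = n → x.unpair.2 ≤ k := by
      intro n
      obtain ⟨k, hk⟩ := (hfin n).bddAbove
      exact ⟨k, fun x hx hxn => (Nat.unpair_right_le x).trans (hk ⟨hx, by simp [hxn]⟩)⟩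
    choose h hh using hbdd
    obtain ⟨f, hf, hle⟩ := hD h
    obtain ⟨j, hj⟩ := eventually_atTop.1 hle
    refine hY (nwdXB_mono (hbelow f hf j) fun x hx => ?_)
    rcases le_total j x.unpair.1 with hjx | hjx
    · exact Or.inl ((hh _ x hx rfl).trans (hj _ hjx))
    · exact Or.inr hjx

/-- 𝔡 is the least size of an independent family separating points
whose nowhere dense ideal is not P⁻. -/
theorem stmt18 :
    (∀ B : Set (Set ℕ), IsIndepFamily B → SeparatesPointsFam B →
        Cardinal.mk B < dNumber → IsPMinus (nwdXB B)) ∧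
      ∃ B : Set (Set ℕ), IsIndepFamily B ∧ SeparatesPointsFam B ∧
        Cardinal.mk B = dNumber ∧ ¬ IsPMinus (nwdXB B) := by
  refine ⟨fun B _ _ hcard => ?_, exists_indepFamily_mk_eq_dNumber_not_isPMinus⟩
  exact @isPMinus_isNowhereDense_of_mk_lt_dNumber (XBtop B) _ (isTopologicalBasis_envSets B)
    (mk_envSets_lt aleph0_le_dNumber hcard)
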